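/- arXiv:2009.12704 — 10 statements merged into one kernel-verified Lean document; each statement's English description precedes it below -/
import Mathlib

section
/- For every x ∈ F, the quadratic inequality (γ+ν)·ν·q(x) + (γ+ν)·l(x)·(bᵀx − α) ≥ Q·‖x‖² + γν·(q(x)+l(x)) − l(x)·(cᵀx) − ρ·ν·l(x) holds. -/
open Matrix

/-- The scalar estimate behind the lifted inequality: `r`, `s`, `d` play the roles of
`‖x‖`, `‖x - c‖` and `⟪c, x⟫`. -/
theorem sq_add_mul_le_of_norm_bounds {γ ν ρ r s d : ℝ} (hγ : 0 ≤ γ) (hρ : 0 ≤ ρ) (hγr : γ ≤ r) (hrν : r ≤ ν)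
    (hs : 0 ≤ s) (hrs : r ^ 2 - d ≤ r * s) (hd : γ * d ≤ ρ * r ^ 2) :
    r ^ 2 + γ * ν ≤ (γ + ν) * s + d + ρ * ν := by
  have hcoef : 0 ≤ γ + ν - r := by linarith
  have hmul : 0 ≤ (γ + ν - r) * s := mul_nonneg hcoef hs
  rcases le_or_gt γ ρ with h | h
  · have : 0 ≤ (ρ - γ) * ν := mul_nonneg (by linarith) (by linarith)
    linarith
  have hγ0 : 0 < γ := hρ.trans_lt h
  have hr : 0 < r := hγ0.trans_le hγr
  have hγs : (γ - ρ) * r ≤ γ * s := by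
    refine le_of_mul_le_mul_left ?_ hr
    linarith [mul_le_mul_of_nonneg_left hrs hγ]
  have hprod : (γ - ρ) * ν ≤ (γ + ν - r) * s := by
    refine le_of_mul_le_mul_left ?_ hγ0
    have h₁ := mul_le_mul_of_nonneg_left hγs hcoef
    have h₂ : 0 ≤ (γ - ρ) * ((r - γ) * (ν - r)) :=
      mul_nonneg (by linarith) (mul_nonneg (by linarith) (by linarith))
    linarith
  linarith

theorem stmt_1 (n : ℕ) (b c : EuclideanSpace ℝ (Fin n)) (α γ ν : ℝ)
    (hγ : 0 ≤ γ) (hγν : γ ≤ ν)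
    (F : Set (EuclideanSpace ℝ (Fin n)))
    (hF : F = {x | γ ≤ ‖x‖ ∧ ‖x‖ ≤ ν ∧ ‖x - c‖ ≤ b ⬝ᵥ x - α})
    (ρ : ℝ) (hρ0 : 0 ≤ ρ) (hρc : ρ ≤ ‖c‖)
    (hρ : ∀ x ∈ F, γ * (c ⬝ᵥ x) ≤ ρ * ‖x‖ ^ 2)
    (Hq : Matrix (Fin n) (Fin n) ℝ) (hHq : Hq.IsSymm)
    (gq gl : EuclideanSpace ℝ (Fin n)) (fq fl : ℝ)
    (q l : EuclideanSpace ℝ (Fin n) → ℝ)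
    (hq : ∀ x, q x = x ⬝ᵥ Hq.mulVec x + 2 * (gq ⬝ᵥ x) + fq)
    (hl : ∀ x, l x = 2 * (gl ⬝ᵥ x) + fl)
    (hqnn : ∀ x ∈ F, 0 ≤ q x) (hlnn : ∀ x ∈ F, 0 ≤ l x)
    (Q : ℝ) (hQ0 : 0 ≤ Q) (hQ : ∀ x ∈ F, Q ≤ q x + l x) :
    ∀ x ∈ F,
      (γ + ν) * ν * q x + (γ + ν) * l x * (b ⬝ᵥ x - α) ≥
        Q * ‖x‖ ^ 2 + γ * ν * (q x + l x) - l x * (c ⬝ᵥ x) - ρ * ν * l x := by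
  intro x hx
  have hqx := hqnn x hx
  have hlx := hlnn x hx
  have hQx := hQ x hx
  have hdx := hρ x hx
  obtain ⟨hγx, hxν, hxc⟩ : γ ≤ ‖x‖ ∧ ‖x‖ ≤ ν ∧ ‖x - c‖ ≤ b ⬝ᵥ x - α := by
    rw [hF] at hx
    exact hx
  have hinner : ‖x‖ ^ 2 - c ⬝ᵥ x ≤ ‖x‖ * ‖x - c‖ := by
    have hcx : inner ℝ x c = c ⬝ᵥ x := by
      simp [EuclideanSpace.inner_eq_star_dotProduct]
    have h := real_inner_le_norm x (x - c)
    rwa [inner_sub_right, real_inner_self_eq_norm_sq, hcx] at h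
  have hkey := sq_add_mul_le_of_norm_bounds hγ hρ0 hγx hxν (norm_nonneg _) hinner hdx
  have hsum : 0 ≤ γ + ν := by linarith
  have ht := mul_le_mul_of_nonneg_left hxc hsum
  have hl_mul := mul_le_mul_of_nonneg_left
    (hkey.trans (add_le_add_left (add_le_add_left ht _) _)) hlx
  have hq_mul := mul_le_mul_of_nonneg_left (pow_le_pow_left₀ (norm_nonneg x) hxν 2) hqx
  have hQ_mul := mul_le_mul_of_nonneg_right hQx (sq_nonneg ‖x‖)
  linarith
end

section
/- Every point (x, X) of G satisfies the linear inequality (γ+ν)·ν·(⟨H_q, X⟩ + 2 g_qᵀx + f_q) + (γ+ν)·(2·g_lᵀ X b + (f_l·b − 2α·g_l)ᵀx − α·f_l) ≥ Q·tr(X) + γν·(⟨H_q, X⟩ + 2(g_q + g_l)ᵀx + f_q + f_l) − (2·g_lᵀ X c + f_l·cᵀx) − ρν·(2 g_lᵀx + f_l), where ⟨M, X⟩ := tr(MᵀX). -/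
open Matrix

/-- The radial inequality behind the valid cut: here `r = ‖x‖`, `t = cᵀx` and `d = ‖x - c‖`. -/
theorem radial_cut_inequality {γ ν r ρ t d : ℝ} (hγ : 0 ≤ γ) (hγr : γ ≤ r) (hrν : r ≤ ν)
    (hρ0 : 0 ≤ ρ) (hd : 0 ≤ d) (ht : r = 0 → t = 0) (hρ : γ * t ≤ ρ * r ^ 2)
    (hcs : r ^ 2 - t ≤ r * d) :
    γ * ν + r ^ 2 ≤ (γ + ν) * d + t + ρ * ν := by
  rcases (hγ.trans hγr).eq_or_lt with hr | hr
  · have hγ0 : γ = 0 := by linarith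
    have ht0 := ht hr.symm
    subst hγ0 hr ht0
    nlinarith [mul_nonneg hrν hd, mul_nonneg hρ0 hrν]
  have hcoef : γ - ρ ≤ d := by
    rcases le_or_gt γ ρ with h | h
    · linarith
    have hγpos : 0 < γ := hρ0.trans_lt h
    have h1 : (γ - ρ) * r ≤ γ * d := by
      refine le_of_mul_le_mul_left ?_ hr
      nlinarith [mul_le_mul_of_nonneg_left hcs hγ]
    refine le_of_mul_le_mul_left ?_ hγpos
    nlinarith [mul_le_mul_of_nonneg_left hγr (sub_pos.2 h).le]
  have hbase : (γ - ρ) * r + (r ^ 2 - t) ≤ (γ + r) * d := by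
    refine le_of_mul_le_mul_left ?_ hr
    nlinarith [mul_le_mul_of_nonneg_left hcs hγ, mul_le_mul_of_nonneg_left hcs hr.le]
  nlinarith [mul_le_mul_of_nonneg_left hcoef (sub_nonneg.2 hrν)]

theorem EuclideanSpace.dotProduct_eq_inner {n : ℕ} (x y : EuclideanSpace ℝ (Fin n)) :
    x ⬝ᵥ y = inner ℝ x y := by
  simp [EuclideanSpace.inner_eq_star_dotProduct, dotProduct_comm]

/-- An affine inequality need only be checked on the generators of a closed convex hull. -/
theorem nonneg_on_closure_convexHull {E : Type*} [AddCommGroup E] [Module ℝ E]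
    [TopologicalSpace E] {s : Set E} {f : E → ℝ} (hf : Continuous f)
    (hconv : ∀ p q : E, ∀ a b : ℝ, a + b = 1 → f (a • p + b • q) = a * f p + b * f q)
    (hs : ∀ p ∈ s, 0 ≤ f p) : ∀ p ∈ closure (convexHull ℝ s), 0 ≤ f p := by
  have hsub : closure (convexHull ℝ s) ⊆ {p | 0 ≤ f p} := by
    refine closure_minimal (convexHull_min hs ?_) (isClosed_le continuous_const hf)
    intro p hp q hq a b ha hb hab
    rw [Set.mem_ofPred_eq, hconv p q a b hab]
    exact add_nonneg (mul_nonneg ha hp) (mul_nonneg hb hq)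
  exact fun p hp => hsub hp

theorem stmt_2 (n : ℕ) (b c : EuclideanSpace ℝ (Fin n)) (α γ ν : ℝ)
    (hγ : 0 ≤ γ) (hγν : γ ≤ ν)
    (F : Set (EuclideanSpace ℝ (Fin n)))
    (hF : F = {x | γ ≤ ‖x‖ ∧ ‖x‖ ≤ ν ∧ ‖x - c‖ ≤ b ⬝ᵥ x - α})
    (G : Set (EuclideanSpace ℝ (Fin n) × Matrix (Fin n) (Fin n) ℝ))
    (hG : G = closure (convexHull ℝ {p | ∃ x ∈ F, p = (x, Matrix.vecMulVec x x)}))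
    (ρ : ℝ) (hρ0 : 0 ≤ ρ) (hρc : ρ ≤ ‖c‖)
    (hρ : ∀ x ∈ F, γ * (c ⬝ᵥ x) ≤ ρ * ‖x‖ ^ 2)
    (Hq : Matrix (Fin n) (Fin n) ℝ) (hHq : Hq.IsSymm)
    (gq gl : EuclideanSpace ℝ (Fin n)) (fq fl : ℝ)
    (q l : EuclideanSpace ℝ (Fin n) → ℝ)
    (hq : ∀ x, q x = x ⬝ᵥ Hq.mulVec x + 2 * (gq ⬝ᵥ x) + fq)
    (hl : ∀ x, l x = 2 * (gl ⬝ᵥ x) + fl)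
    (hqnn : ∀ x ∈ F, 0 ≤ q x) (hlnn : ∀ x ∈ F, 0 ≤ l x)
    (Q : ℝ) (hQ0 : 0 ≤ Q) (hQ : ∀ x ∈ F, Q ≤ q x + l x) :
    ∀ p ∈ G,
      (γ + ν) * ν * ((Hqᵀ * p.2).trace + 2 * (gq ⬝ᵥ p.1) + fq) +
          (γ + ν) * (2 * (gl ⬝ᵥ p.2.mulVec b) +
            ((fl • b - (2 * α) • gl) ⬝ᵥ p.1) - α * fl) ≥
        Q * p.2.trace +
          γ * ν * ((Hqᵀ * p.2).trace + 2 * ((gq + gl) ⬝ᵥ p.1) + (fq + fl)) -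
          (2 * (gl ⬝ᵥ p.2.mulVec c) + fl * (c ⬝ᵥ p.1)) -
          ρ * ν * (2 * (gl ⬝ᵥ p.1) + fl) := by
  intro p hp
  rw [ge_iff_le, ← sub_nonneg]
  rw [hG] at hp
  revert p
  refine nonneg_on_closure_convexHull (by fun_prop) ?_ ?_
  · rintro ⟨x, X⟩ ⟨y, Y⟩ s t hst
    obtain rfl : t = 1 - s := by linarith
    simp only [Prod.smul_mk, Prod.mk_add_mk, WithLp.ofLp_add, WithLp.ofLp_smul, WithLp.ofLp_sub,
      dotProduct_add, dotProduct_smul, add_dotProduct, sub_dotProduct, smul_dotProduct,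
      Matrix.mul_add, Matrix.mul_smul, trace_add, trace_smul, add_mulVec, smul_mulVec,
      smul_eq_mul]
    ring
  · rintro _ ⟨x, hx, rfl⟩
    have hxF := hx
    rw [hF] at hxF
    obtain ⟨h1, h2, h3⟩ := hxF
    have hq0 := hqnn x hx
    have hl0 := hlnn x hx
    have hQx := hQ x hx
    have hxx : x ⬝ᵥ x = ‖x‖ ^ 2 := by
      rw [EuclideanSpace.dotProduct_eq_inner, real_inner_self_eq_norm_sq]
    have hcs : ‖x‖ ^ 2 - c ⬝ᵥ x ≤ ‖x‖ * ‖x - c‖ := by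
      have h := real_inner_le_norm x (x - c)
      rw [inner_sub_right, real_inner_self_eq_norm_sq, real_inner_comm] at h
      rwa [EuclideanSpace.dotProduct_eq_inner]
    have hcut := radial_cut_inequality hγ h1 h2 hρ0 (norm_nonneg (x - c))
      (fun h => by simp [norm_eq_zero.1 h]) (hρ x hx) hcs
    have hcut' : γ * ν + ‖x‖ ^ 2 ≤ (γ + ν) * (b ⬝ᵥ x - α) + c ⬝ᵥ x + ρ * ν := by
      nlinarith [mul_le_mul_of_nonneg_left h3 (add_nonneg hγ (hγ.trans hγν))]
    have htr : (Hqᵀ * vecMulVec x x).trace = x ⬝ᵥ Hq.mulVec x := by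
      rw [hHq.eq, mul_vecMulVec, trace_vecMulVec, dotProduct_comm]
    simp only [htr, trace_vecMulVec, vecMulVec_mulVec, WithLp.ofLp_add, WithLp.ofLp_smul,
      WithLp.ofLp_sub, add_dotProduct, sub_dotProduct, smul_dotProduct, dotProduct_smul, hxx,
      smul_eq_mul, MulOpposite.smul_eq_mul_unop, MulOpposite.unop_op,
      dotProduct_comm x.ofLp b.ofLp, dotProduct_comm x.ofLp c.ofLp]
    have hqe := hq x
    have hle := hl x
    have hsq : ‖x‖ ^ 2 ≤ ν ^ 2 := by gcongr
    have hA := mul_le_mul_of_nonneg_right hQx (sq_nonneg ‖x‖)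
    have hB := mul_le_mul_of_nonneg_left hsq hq0
    have hC := mul_le_mul_of_nonneg_left hcut' hl0
    rw [hqe, hle] at hA
    rw [hqe] at hB
    rw [hle] at hC
    linarith
end

section
/- For every x ∈ F, the inequality (γ+ν)·(bᵀx − α) ≥ ‖x‖² + γν − cᵀx − ρν holds. -/
open Matrix

theorem norm_sq_sub_dotProduct_le {n : ℕ} (c x : EuclideanSpace ℝ (Fin n)) :
    ‖x‖ ^ 2 - c ⬝ᵥ x ≤ ‖x‖ * ‖x - c‖ := by
  have h : inner ℝ x c = c ⬝ᵥ x := by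
    simp [EuclideanSpace.inner_eq_star_dotProduct]
  rw [← h, ← real_inner_self_eq_norm_sq, ← inner_sub_right]
  exact real_inner_le_norm x (x - c)

theorem sq_add_mul_sub_sub_le {γ ν ρ r s t : ℝ} (hγ : 0 ≤ γ) (hγr : γ ≤ r) (hrν : r ≤ ν)
    (hρ : 0 ≤ ρ) (hs : 0 ≤ s) (hrs : r ^ 2 - t ≤ r * s) (ht : γ * t ≤ ρ * r ^ 2)
    (h0 : r = 0 → t = 0) :
    r ^ 2 + γ * ν - t - ρ * ν ≤ (γ + ν) * s := by
  have hr : 0 ≤ r := hγ.trans hγr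
  have hν : 0 ≤ ν := hr.trans hrν
  rcases hr.eq_or_lt with hr0 | hr0
  · have hγ0 : γ = 0 := by linarith
    rw [h0 hr0.symm, ← hr0, hγ0]
    nlinarith [mul_nonneg hρ hν, mul_nonneg hν hs]
  · refine le_of_mul_le_mul_right ?_ (pow_pos hr0 2)
    calc (r ^ 2 + γ * ν - t - ρ * ν) * r ^ 2
        ≤ (r ^ 2 - t) * (r ^ 2 + γ * ν) := by
          linarith [mul_le_mul_of_nonneg_left ht hν]
      _ ≤ r * s * (r ^ 2 + γ * ν) := by gcongr
      _ ≤ r * s * (r * (γ + ν)) := by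
          gcongr
          linarith [mul_nonneg (sub_nonneg.2 hγr) (sub_nonneg.2 hrν)]
      _ = (γ + ν) * s * r ^ 2 := by ring



theorem stmt_5 (n : ℕ) (b c : EuclideanSpace ℝ (Fin n)) (α γ ν : ℝ)
    (hγ : 0 ≤ γ) (hγν : γ ≤ ν)
    (F : Set (EuclideanSpace ℝ (Fin n)))
    (hF : F = {x | γ ≤ ‖x‖ ∧ ‖x‖ ≤ ν ∧ ‖x - c‖ ≤ b ⬝ᵥ x - α})
    (ρ : ℝ) (hρ0 : 0 ≤ ρ)
    (hρ : ∀ x ∈ F, γ * (c ⬝ᵥ x) ≤ ρ * ‖x‖ ^ 2) :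
    ∀ x ∈ F, (γ + ν) * (b ⬝ᵥ x - α) ≥ ‖x‖ ^ 2 + γ * ν - c ⬝ᵥ x - ρ * ν := by
  subst hF
  intro x hx
  exact sq_add_mul_sub_sub_le hγ hx.1 hx.2.1 hρ0 ((norm_nonneg _).trans hx.2.2)
    ((norm_sq_sub_dotProduct_le c x).trans (mul_le_mul_of_nonneg_left hx.2.2 (norm_nonneg x)))
    (hρ x hx) fun h => by simp [norm_eq_zero.1 h]
end

section
/- Suppose s ∈ ℝⁿ and λ, μ ∈ ℝ are such that λ ≤ sᵀx ≤ μ for all x ∈ F (a valid slab). Then for every x ∈ F, (γ+ν)·ν·(μ − sᵀx) + (γ+ν)·(sᵀx − λ)·(bᵀx − α) ≥ (μ − λ)·(‖x‖² + γν) − (sᵀx − λ)·(cᵀx) − ρν·(sᵀx − λ). -/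
open Matrix

/-- The scalar inequality behind the slab cut: `r`, `d`, `t` stand for `‖x‖`, `cᵀx`, `bᵀx - α`. -/
theorem slab_coefficient_nonneg {γ ν ρ r d t : ℝ} (hγ : 0 ≤ γ) (hγr : γ ≤ r) (hrν : r ≤ ν)
    (hρ0 : 0 ≤ ρ) (hρ : γ * d ≤ ρ * r ^ 2) (ht : 0 ≤ t) (htr : r ^ 2 - d ≤ t * r)
    (hd : r = 0 → d = 0) :
    0 ≤ (γ + ν) * t - r ^ 2 - γ * ν + d + ρ * ν := by
  have hr : 0 ≤ r := hγ.trans hγr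
  have hν : 0 ≤ ν := hr.trans hrν
  rcases hr.eq_or_lt with h | h
  · have hγ0 : γ = 0 := by linarith
    rw [hd h.symm, ← h, hγ0]
    nlinarith [mul_nonneg hν ht, mul_nonneg hρ0 hν]
  · refine nonneg_of_mul_nonneg_right ?_ (pow_pos h 2)
    have hρν : 0 ≤ ν * (ρ * r ^ 2 - γ * d) := mul_nonneg hν (by linarith)
    rcases le_total d (r ^ 2) with hdr | hdr
    · have h₁ : 0 ≤ (γ + ν) * r * (t * r - (r ^ 2 - d)) :=
        mul_nonneg (by positivity) (by linarith)
      have h₂ : 0 ≤ (r - γ) * (ν - r) * (r ^ 2 - d) :=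
        mul_nonneg (mul_nonneg (by linarith) (by linarith)) (by linarith)
      linarith
    · have h₁ : 0 ≤ r ^ 2 * ((γ + ν) * t) := by positivity
      have h₂ : 0 ≤ (r ^ 2 + γ * ν) * (d - r ^ 2) :=
        mul_nonneg (by positivity) (by linarith)
      linarith

theorem stmt_6 (n : ℕ) (b c : EuclideanSpace ℝ (Fin n)) (α γ ν : ℝ)
    (hγ : 0 ≤ γ) (hγν : γ ≤ ν)
    (F : Set (EuclideanSpace ℝ (Fin n)))
    (hF : F = {x | γ ≤ ‖x‖ ∧ ‖x‖ ≤ ν ∧ ‖x - c‖ ≤ b ⬝ᵥ x - α})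
    (ρ : ℝ) (hρ0 : 0 ≤ ρ)
    (hρ : ∀ x ∈ F, γ * (c ⬝ᵥ x) ≤ ρ * ‖x‖ ^ 2)
    (s : EuclideanSpace ℝ (Fin n)) (lam μ : ℝ)
    (hslab : ∀ x ∈ F, lam ≤ s ⬝ᵥ x ∧ s ⬝ᵥ x ≤ μ) :
    ∀ x ∈ F,
      (γ + ν) * ν * (μ - s ⬝ᵥ x) + (γ + ν) * (s ⬝ᵥ x - lam) * (b ⬝ᵥ x - α) ≥
        (μ - lam) * (‖x‖ ^ 2 + γ * ν) - (s ⬝ᵥ x - lam) * (c ⬝ᵥ x) -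
          ρ * ν * (s ⬝ᵥ x - lam) := by
  intro x hx
  obtain ⟨hl, hu⟩ := hslab x hx
  have hρx := hρ x hx
  rw [hF] at hx
  obtain ⟨hγx, hxν, hxc⟩ := hx
  have hdot : c ⬝ᵥ x = inner ℝ x c := by
    simp [EuclideanSpace.inner_eq_star_dotProduct]
  have hcs : ‖x‖ ^ 2 - c ⬝ᵥ x ≤ (b ⬝ᵥ x - α) * ‖x‖ := by
    have h := real_inner_le_norm x (x - c)
    rw [inner_sub_right, real_inner_self_eq_norm_sq, ← hdot] at h
    linarith [mul_le_mul_of_nonneg_right hxc (norm_nonneg x)]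
  have hzero : ‖x‖ = 0 → c ⬝ᵥ x = 0 := fun h => by
    rw [hdot, norm_eq_zero.mp h, inner_zero_left]
  have hq := mul_nonneg (sub_nonneg.mpr hl)
    (slab_coefficient_nonneg hγ hγx hxν hρ0 hρx ((norm_nonneg _).trans hxc) hcs hzero)
  have hp : 0 ≤ (μ - s ⬝ᵥ x) * (ν ^ 2 - ‖x‖ ^ 2) :=
    mul_nonneg (by linarith) (sub_nonneg.mpr (pow_le_pow_left₀ (norm_nonneg x) hxν 2))
  linarith
end

section
/- Let 𝒥_C ⊆ ℝ⁴ be the closed convex hull of the set of points (|z₁|², |z₂|², Re(z₁·conj(z₂)), Im(z₁·conj(z₂))) over all (z₁, z₂) ∈ ℂ² satisfying L₁₁ ≤ |z₁|² ≤ U₁₁, L₂₂ ≤ |z₂|² ≤ U₂₂, L₁₂·Re(z₁·conj(z₂)) ≤ Im(z₁·conj(z₂)) ≤ U₁₂·Re(z₁·conj(z₂)), and Re(z₁·conj(z₂)) ≥ 0. Let F ⊆ ℝ³ be the set of x with L₁₁ ≤ x₁² + x₂² ≤ U₁₁, L₂₂ ≤ x₃² ≤ U₂₂, L₁₂·x₁x₃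 ≤ x₂x₃ ≤ U₁₂·x₁x₃, x₁x₃ ≥ 0, and x₃ ≥ 0, and let G be the closure of the convex hull of {(x, x xᵀ) : x ∈ F} in ℝ³ × (3×3 real matrices). Then 𝒥_C = {(X₁₁ + X₂₂, X₃₃, X₁₃, X₂₃) : (x, X) ∈ G}. -/
open Matrix Complex

/-- The linear map sending `(x, X)` to `(X₁₁ + X₂₂, X₃₃, X₁₃, X₂₃)`. -/
def liftProjection :
    EuclideanSpace ℝ (Fin 3) × Matrix (Fin 3) (Fin 3) ℝ →ₗ[ℝ] (Fin 4 → ℝ) where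
  toFun p := ![p.2 0 0 + p.2 1 1, p.2 2 2, p.2 0 2, p.2 1 2]
  map_add' p q := by
    ext i
    fin_cases i <;> simp; ring
  map_smul' c p := by
    ext i
    fin_cases i <;> simp; ring

lemma continuous_liftProjection : Continuous liftProjection := by
  change Continuous fun p : EuclideanSpace ℝ (Fin 3) × Matrix (Fin 3) (Fin 3) ℝ =>
    ![p.2 0 0 + p.2 1 1, p.2 2 2, p.2 0 2, p.2 1 2]
  have h (i j : Fin 3) :
      Continuous fun p : EuclideanSpace ℝ (Fin 3) × Matrix (Fin 3) (Fin 3) ℝ => p.2 i j :=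
    continuous_snd.matrix_elem i j
  refine continuous_pi fun i => ?_
  fin_cases i
  exacts [(h 0 0).add (h 1 1), h 2 2, h 0 2, h 1 2]

/-- The closed convex hull of the lifting `x ↦ (x, x xᵀ)` of a bounded set is compact. -/
lemma isCompact_closure_convexHull_lift {ι : Type*} [Fintype ι] {F : Set (EuclideanSpace ℝ ι)}
    {M : ℝ} (hF : ∀ x ∈ F, ‖x‖ ^ 2 ≤ M) :
    IsCompact (closure (convexHull ℝ {p : EuclideanSpace ℝ ι × Matrix ι ι ℝ |
      ∃ x ∈ F, p = (x, Matrix.vecMulVec x x)})) := by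
  let B : Set (Matrix ι ι ℝ) := Set.univ.pi fun _ => Set.univ.pi fun _ => Set.Icc (-M) M
  have hB : IsCompact B :=
    isCompact_univ_pi fun _ => isCompact_univ_pi fun _ => isCompact_Icc
  have hBconv : Convex ℝ B :=
    convex_pi fun _ _ => convex_pi fun _ _ => convex_Icc _ _
  refine ((isCompact_closedBall (0 : EuclideanSpace ℝ ι) √M).prod hB).closure_of_subset
    (convexHull_min ?_ ((convex_closedBall _ _).prod hBconv))
  rintro _ ⟨x, hx, rfl⟩
  have hM := hF x hx
  refine ⟨by simpa using Real.le_sqrt_of_sq_le hM, fun i _ j _ => abs_le.1 ?_⟩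
  have hi := PiLp.norm_apply_le x i
  have hj := PiLp.norm_apply_le x j
  calc |Matrix.vecMulVec x x i j| = ‖x i‖ * ‖x j‖ := by
        simp [Matrix.vecMulVec_apply, abs_mul]
    _ ≤ ‖x‖ * ‖x‖ := by gcongr
    _ ≤ M := by rwa [← sq]

/-- Rotating both coordinates by a common phase makes the second one real and nonnegative. -/
lemma exists_phase_normalization (z₁ z₂ : ℂ) :
    ∃ (u : ℂ) (r : ℝ), 0 ≤ r ∧ normSq u = normSq z₁ ∧ r ^ 2 = normSq z₂ ∧
      u * r = z₁ * (starRingEnd ℂ) z₂ := by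
  rcases eq_or_ne z₂ 0 with rfl | h
  · exact ⟨z₁, 0, by simp⟩
  · have hr : ‖z₂‖ ≠ 0 := norm_ne_zero_iff.2 h
    refine ⟨z₁ * (starRingEnd ℂ) z₂ / ‖z₂‖, ‖z₂‖, norm_nonneg _, ?_, (normSq_eq_norm_sq _).symm,
      div_mul_cancel₀ _ (by exact_mod_cast hr)⟩
    simp only [normSq_eq_norm_sq, norm_div, norm_mul, RCLike.norm_conj, norm_real, norm_norm]
    field_simp

theorem stmt_12 (L11 L22 L12 U11 U22 U12 : ℝ)
    (h11 : L11 ≤ U11) (h22 : L22 ≤ U22) (h12 : L12 ≤ U12)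
    (hL11 : 0 ≤ L11) (hL22 : 0 ≤ L22)
    (JC : Set (Fin 4 → ℝ))
    (hJC : JC = closure (convexHull ℝ
      {w : Fin 4 → ℝ | ∃ z1 z2 : ℂ,
        (L11 ≤ Complex.normSq z1 ∧ Complex.normSq z1 ≤ U11) ∧
        (L22 ≤ Complex.normSq z2 ∧ Complex.normSq z2 ≤ U22) ∧
        (L12 * (z1 * (starRingEnd ℂ) z2).re ≤ (z1 * (starRingEnd ℂ) z2).im ∧
          (z1 * (starRingEnd ℂ) z2).im ≤ U12 * (z1 * (starRingEnd ℂ) z2).re) ∧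
        0 ≤ (z1 * (starRingEnd ℂ) z2).re ∧
        w = ![Complex.normSq z1, Complex.normSq z2,
              (z1 * (starRingEnd ℂ) z2).re, (z1 * (starRingEnd ℂ) z2).im]}))
    (F : Set (EuclideanSpace ℝ (Fin 3)))
    (hF : F = {x | (L11 ≤ x 0 ^ 2 + x 1 ^ 2 ∧ x 0 ^ 2 + x 1 ^ 2 ≤ U11) ∧
      (L22 ≤ x 2 ^ 2 ∧ x 2 ^ 2 ≤ U22) ∧
      (L12 * (x 0 * x 2) ≤ x 1 * x 2 ∧ x 1 * x 2 ≤ U12 * (x 0 * x 2)) ∧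
      0 ≤ x 0 * x 2 ∧ 0 ≤ x 2})
    (G : Set (EuclideanSpace ℝ (Fin 3) × Matrix (Fin 3) (Fin 3) ℝ))
    (hG : G = closure (convexHull ℝ {p | ∃ x ∈ F, p = (x, Matrix.vecMulVec x x)})) :
    JC = {w : Fin 4 → ℝ | ∃ p ∈ G,
      w = ![p.2 0 0 + p.2 1 1, p.2 2 2, p.2 0 2, p.2 1 2]} := by
  have hnorm : ∀ x ∈ F, ‖x‖ ^ 2 ≤ U11 + U22 := by
    intro x hx
    rw [hF] at hx
    obtain ⟨⟨-, h1⟩, ⟨-, h2⟩, -⟩ := hx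
    rw [EuclideanSpace.real_norm_sq_eq, Fin.sum_univ_three]
    linarith
  have hcompact := isCompact_closure_convexHull_lift hnorm
  have himage : JC = liftProjection '' G := by
    rw [hJC, hG, image_closure_of_isCompact hcompact continuous_liftProjection.continuousOn,
      LinearMap.image_convexHull]
    congr 2
    ext w
    constructor
    · rintro ⟨z1, z2, h1, h2, h3, h4, rfl⟩
      obtain ⟨u, r, hr, hu, hr2, hur⟩ := exists_phase_normalization z1 z2
      rw [← hu] at h1
      rw [← hr2] at h2
      rw [← hur] at h3 h4
      rw [← hur, ← hu, ← hr2]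
      simp only [normSq_apply, re_mul_ofReal, im_mul_ofReal, ← sq] at *
      refine ⟨_, ⟨!₂[u.re, u.im, r], ?_, rfl⟩, ?_⟩
      · rw [hF]
        exact ⟨h1, h2, h3, h4, hr⟩
      · simp [liftProjection, ← sq]
    · rintro ⟨_, ⟨x, hx, rfl⟩, rfl⟩
      rw [hF] at hx
      obtain ⟨h1, h2, h3, h4, -⟩ := hx
      refine ⟨⟨x 0, x 1⟩, (x 2 : ℝ), ?_⟩
      simp only [conj_ofReal, re_mul_ofReal, im_mul_ofReal, normSq_ofReal, normSq_mk, ← sq]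
      exact ⟨h1, h2, h3, h4, by simp [liftProjection, Matrix.vecMulVec_apply, ← sq]⟩
  rw [himage]
  ext w
  exact exists_congr fun p => and_congr_right fun _ => eq_comm
end

section
/- Suppose L₂₂ > 0 and U₁₂ > L₁₂. Then F equals the set of x ∈ ℝ³ satisfying √L₁₁ ≤ √(x₁² + x₂²) ≤ √U₁₁, √(x₁² + x₂²) ≤ b₁x₁ + b₂x₂, and √L₂₂ ≤ x₃ ≤ √U₂₂, where (b₁, b₂) is the unique solution of the linear system b₁ + L₁₂·b₂ = √(1 + L₁₂²), b₁ + U₁₂·b₂ = √(1 + U₁₂²). -/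
/-- The planar cone spanned by `(1, L)` and `(1, U)` is the region where the Euclidean norm is
dominated by the linear functional agreeing with the norm at both generators. -/
theorem sqrt_sq_add_sq_le_linear_iff {L U b₁ b₂ : ℝ} (hLU : L < U)
    (hL : b₁ + L * b₂ = √(1 + L ^ 2)) (hU : b₁ + U * b₂ = √(1 + U ^ 2)) (a c : ℝ) :
    √(a ^ 2 + c ^ 2) ≤ b₁ * a + b₂ * c ↔ (L * a ≤ c ∧ c ≤ U * a) ∧ 0 ≤ a := by
  obtain ⟨s, t, rfl, rfl⟩ : ∃ s t : ℝ, a = s + t ∧ c = s * L + t * U := by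
    have hne : U - L ≠ 0 := by linarith
    refine ⟨(U * a - c) / (U - L), (c - L * a) / (U - L), ?_, ?_⟩ <;> field_simp <;> ring
  set p := √(1 + L ^ 2) with hp
  set q := √(1 + U ^ 2) with hq
  have hp2 : p ^ 2 = 1 + L ^ 2 := Real.sq_sqrt (by positivity)
  have hq2 : q ^ 2 = 1 + U ^ 2 := Real.sq_sqrt (by positivity)
  have hp0 : 0 < p := Real.sqrt_pos.2 (by positivity)
  have hq0 : 0 < q := Real.sqrt_pos.2 (by positivity)
  have hpq : 0 < p * q - (1 + L * U) := by
    have hlt : (1 + L * U) ^ 2 < (p * q) ^ 2 := by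
      rw [mul_pow, hp2, hq2]
      nlinarith [sq_pos_of_pos (sub_pos.2 hLU)]
    linarith [lt_of_pow_lt_pow_left₀ 2 (mul_pos hp0 hq0).le hlt]
  have hw : b₁ * (s + t) + b₂ * (s * L + t * U) = s * p + t * q := by
    rw [← hL, ← hU]; ring
  have hsq : (s * p + t * q) ^ 2 - ((s + t) ^ 2 + (s * L + t * U) ^ 2) =
      2 * (s * t) * (p * q - (1 + L * U)) := by
    linear_combination s ^ 2 * hp2 + t ^ 2 * hq2
  rw [hw, Real.sqrt_le_iff]
  constructor
  · rintro ⟨h0, h⟩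
    have hst : 0 ≤ s * t := by
      by_contra! hneg
      nlinarith [mul_neg_of_neg_of_pos hneg hpq]
    have hs : 0 ≤ s := by
      by_contra! hs
      have ht : t ≤ 0 := nonpos_of_mul_nonneg_right hst hs
      nlinarith [mul_neg_of_neg_of_pos hs hp0, mul_nonneg (neg_nonneg.2 ht) hq0.le]
    have ht : 0 ≤ t := by
      by_contra! ht
      have hs' : s ≤ 0 := nonpos_of_mul_nonneg_left hst ht
      nlinarith [mul_neg_of_neg_of_pos ht hq0, mul_nonneg (neg_nonneg.2 hs') hp0.le]
    exact ⟨⟨by nlinarith, by nlinarith⟩, add_nonneg hs ht⟩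
  · rintro ⟨⟨h1, h2⟩, -⟩
    have hs : 0 ≤ s := nonneg_of_mul_nonneg_left (b := U - L) (by linarith) (sub_pos.2 hLU)
    have ht : 0 ≤ t := nonneg_of_mul_nonneg_left (b := U - L) (by linarith) (sub_pos.2 hLU)
    have := mul_nonneg (mul_nonneg hs ht) hpq.le
    exact ⟨by positivity, by linarith⟩


theorem stmt_13 (L11 L22 L12 U11 U22 U12 : ℝ)
    (h11 : L11 ≤ U11) (h22 : L22 ≤ U22) (h12 : L12 ≤ U12)
    (hL11 : 0 ≤ L11) (hL22pos : 0 < L22) (h12strict : L12 < U12)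
    (F : Set (EuclideanSpace ℝ (Fin 3)))
    (hF : F = {x | (L11 ≤ x 0 ^ 2 + x 1 ^ 2 ∧ x 0 ^ 2 + x 1 ^ 2 ≤ U11) ∧
      (L22 ≤ x 2 ^ 2 ∧ x 2 ^ 2 ≤ U22) ∧
      (L12 * (x 0 * x 2) ≤ x 1 * x 2 ∧ x 1 * x 2 ≤ U12 * (x 0 * x 2)) ∧
      0 ≤ x 0 * x 2 ∧ 0 ≤ x 2})
    (b1 b2 : ℝ)
    (hb1 : b1 + L12 * b2 = Real.sqrt (1 + L12 ^ 2))
    (hb2 : b1 + U12 * b2 = Real.sqrt (1 + U12 ^ 2)) :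
    F = {x : EuclideanSpace ℝ (Fin 3) |
      (Real.sqrt L11 ≤ Real.sqrt (x 0 ^ 2 + x 1 ^ 2) ∧
        Real.sqrt (x 0 ^ 2 + x 1 ^ 2) ≤ Real.sqrt U11) ∧
      Real.sqrt (x 0 ^ 2 + x 1 ^ 2) ≤ b1 * x 0 + b2 * x 1 ∧
      (Real.sqrt L22 ≤ x 2 ∧ x 2 ≤ Real.sqrt U22)} := by
  subst hF
  ext x
  have hN : 0 ≤ x 0 ^ 2 + x 1 ^ 2 := by positivity
  have hscale (h : 0 < x 2) : ((L12 * (x 0 * x 2) ≤ x 1 * x 2 ∧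
      x 1 * x 2 ≤ U12 * (x 0 * x 2)) ∧ 0 ≤ x 0 * x 2) ↔
      (L12 * x 0 ≤ x 1 ∧ x 1 ≤ U12 * x 0) ∧ 0 ≤ x 0 := by
    rw [← mul_assoc, ← mul_assoc, mul_le_mul_iff_left₀ h, mul_le_mul_iff_left₀ h,
      mul_nonneg_iff_of_pos_right h]
  change _ ∧ _ ∧ _ ∧ _ ∧ _ ↔ _ ∧ _ ∧ _ ∧ _
  rw [sqrt_sq_add_sq_le_linear_iff h12strict hb1 hb2, Real.sqrt_le_sqrt_iff hN,
    Real.sqrt_le_sqrt_iff (hL11.trans h11)]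
  constructor
  · rintro ⟨hnorm, ⟨hlo, hhi⟩, hcone, hpos, h2⟩
    have h2' : 0 < x 2 := h2.lt_of_ne' fun h => by simp [h] at hlo; linarith
    exact ⟨hnorm, (hscale h2').1 ⟨hcone, hpos⟩, Real.sqrt_le_iff.2 ⟨h2, hlo⟩,
      Real.le_sqrt_of_sq_le hhi⟩
  · rintro ⟨hnorm, hcone, hlo, hhi⟩
    have h2 : 0 < x 2 := (Real.sqrt_pos.2 hL22pos).trans_le hlo
    obtain ⟨hcone', hpos⟩ := (hscale h2).2 hcone
    exact ⟨hnorm, ⟨(Real.sqrt_le_iff.1 hlo).2, (Real.le_sqrt' h2).1 hhi⟩, hcone', hpos, h2.le⟩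
end

section
/- For every x ∈ ℝ³ with L₁₁ ≤ x₁² + x₂² ≤ U₁₁, L₂₂ ≤ x₃² ≤ U₂₂, L₁₂·x₁x₃ ≤ x₂x₃ ≤ U₁₂·x₁x₃, x₁x₃ ≥ 0, and x₃ ≥ 0, one has π₀ + π₁·(x₁² + x₂²) + π₂·x₃² + π₃·x₁x₃ + π₄·x₂x₃ ≥ U₂₂·(x₁² + x₂²) + U₁₁·x₃² − U₁₁U₂₂. -/
/-- The half-angle tangent in the form without a singularity at `0`. -/
theorem sqrt_one_add_sq_sub_one_div {t : ℝ} (ht : 0 < t) :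
    (√(1 + t ^ 2) - 1) / t = t / (√(1 + t ^ 2) + 1) := by
  have hs : √(1 + t ^ 2) ^ 2 = 1 + t ^ 2 := Real.sq_sqrt (by positivity)
  have : 0 ≤ √(1 + t ^ 2) := Real.sqrt_nonneg _
  rw [div_eq_div_iff ht.ne' (by positivity)]
  linear_combination hs

/-- If the slope of `(x, y)` is at least `t`, its half-angle slope is at least that of `t`. -/
theorem half_slope_mul_le {t x y : ℝ} (ht : 0 ≤ t) (hx : 0 ≤ x) (h : t * x ≤ y) :
    t / (√(1 + t ^ 2) + 1) * (√(x ^ 2 + y ^ 2) + x) ≤ y := by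
  have hy : 0 ≤ y := (mul_nonneg ht hx).trans h
  have hr : √(x ^ 2 + y ^ 2) ^ 2 = x ^ 2 + y ^ 2 := Real.sq_sqrt (by positivity)
  have hs : √(1 + t ^ 2) ^ 2 = 1 + t ^ 2 := Real.sq_sqrt (by positivity)
  have hsq : (t * x) ^ 2 ≤ y ^ 2 := pow_le_pow_left₀ (by positivity) h 2
  have key : t * √(x ^ 2 + y ^ 2) ≤ y * √(1 + t ^ 2) := by
    refine (sq_le_sq₀ (by positivity) (by positivity)).1 ?_
    rw [mul_pow, mul_pow, hr, hs]
    linarith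
  rw [div_mul_eq_mul_div, div_le_iff₀ (by positivity)]
  linarith

/-- If the slope of `(x, y)` is at most `t`, its half-angle slope is at most that of `t`. -/
theorem le_half_slope_mul {t x y : ℝ} (ht : 0 ≤ t) (hy : 0 ≤ y) (h : y ≤ t * x) :
    y ≤ t / (√(1 + t ^ 2) + 1) * (√(x ^ 2 + y ^ 2) + x) := by
  have hr : √(x ^ 2 + y ^ 2) ^ 2 = x ^ 2 + y ^ 2 := Real.sq_sqrt (by positivity)
  have hs : √(1 + t ^ 2) ^ 2 = 1 + t ^ 2 := Real.sq_sqrt (by positivity)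
  have hsq : y ^ 2 ≤ (t * x) ^ 2 := pow_le_pow_left₀ hy h 2
  have key : y * √(1 + t ^ 2) ≤ t * √(x ^ 2 + y ^ 2) := by
    refine (sq_le_sq₀ (by positivity) (by positivity)).1 ?_
    rw [mul_pow, mul_pow, hr, hs]
    linarith
  rw [div_mul_eq_mul_div, le_div_iff₀ (by positivity)]
  linarith

/-- The chord of a circular arc, in terms of half-angle slopes `p`, `q` of its endpoints. -/
theorem norm_le_of_half_slope {p q x y r : ℝ} (hrx : 0 < r + x) (hr : r ^ 2 = x ^ 2 + y ^ 2)
    (hp : p * (r + x) ≤ y) (hq : y ≤ q * (r + x)) :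
    (1 + p * q) * r ≤ (1 - p * q) * x + (p + q) * y := by
  refine le_of_sub_nonneg (nonneg_of_mul_nonneg_right ?_ hrx)
  have h := mul_nonneg (sub_nonneg.2 hp) (sub_nonneg.2 hq)
  linear_combination h + hr

/-- A quadratic, vanishing at three of the vertices, that is nonnegative on the rectangle `[a, A] × [b, B]`. -/
theorem rectangle_quadratic_nonneg {a A b B r z : ℝ} (ha : 0 ≤ a) (hb : 0 ≤ b)
    (har : a ≤ r) (hrA : r ≤ A) (hbz : b ≤ z) (hzB : z ≤ B) :
    0 ≤ A ^ 2 * B ^ 2 - a * b * A * B - B * (b + B) * r ^ 2 - A * (a + A) * z ^ 2 +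
      (a + A) * (b + B) * (r * z) := by
  have hA : 0 ≤ A := ha.trans (har.trans hrA)
  have hB : 0 ≤ B := hb.trans (hbz.trans hzB)
  have h₁ : 0 ≤ B * (b + B) * ((r - a) * (A - r)) :=
    mul_nonneg (by positivity) (mul_nonneg (sub_nonneg.2 har) (sub_nonneg.2 hrA))
  have h₂ : 0 ≤ A * (a + A) * ((z - b) * (B - z)) :=
    mul_nonneg (by positivity) (mul_nonneg (sub_nonneg.2 hbz) (sub_nonneg.2 hzB))
  have h₃ : 0 ≤ (a + A) * (b + B) * ((A - r) * (B - z)) :=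
    mul_nonneg (by positivity) (mul_nonneg (sub_nonneg.2 hrA) (sub_nonneg.2 hzB))
  linear_combination h₁ + h₂ + h₃

theorem stmt_14 (L11 L22 L12 U11 U22 U12 : ℝ)
    (hL11 : 0 ≤ L11) (h11 : L11 ≤ U11)
    (hL22 : 0 < L22) (h22 : L22 ≤ U22)
    (hL12 : 0 ≤ L12) (h12 : L12 < U12)
    (f : ℝ → ℝ) (hf0 : f 0 = 0)
    (hf : ∀ t : ℝ, 0 < t → f t = (Real.sqrt (1 + t ^ 2) - 1) / t)
    (π₀ π₁ π₂ π₃ π₄ : ℝ)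
    (hπ₀ : π₀ = -Real.sqrt (L11 * L22 * U11 * U22))
    (hπ₁ : π₁ = -Real.sqrt (L22 * U22))
    (hπ₂ : π₂ = -Real.sqrt (L11 * U11))
    (hπ₃ : π₃ = (Real.sqrt L11 + Real.sqrt U11) * (Real.sqrt L22 + Real.sqrt U22) *
      ((1 - f L12 * f U12) / (1 + f L12 * f U12)))
    (hπ₄ : π₄ = (Real.sqrt L11 + Real.sqrt U11) * (Real.sqrt L22 + Real.sqrt U22) *
      ((f L12 + f U12) / (1 + f L12 * f U12))) :
    ∀ x1 x2 x3 : ℝ,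
      L11 ≤ x1 ^ 2 + x2 ^ 2 → x1 ^ 2 + x2 ^ 2 ≤ U11 →
      L22 ≤ x3 ^ 2 → x3 ^ 2 ≤ U22 →
      L12 * (x1 * x3) ≤ x2 * x3 → x2 * x3 ≤ U12 * (x1 * x3) →
      0 ≤ x1 * x3 → 0 ≤ x3 →
      π₀ + π₁ * (x1 ^ 2 + x2 ^ 2) + π₂ * x3 ^ 2 + π₃ * (x1 * x3) + π₄ * (x2 * x3) ≥
        U22 * (x1 ^ 2 + x2 ^ 2) + U11 * x3 ^ 2 - U11 * U22 := by
  intro x y z hLr hrU hLz hzU hL hU hxz hz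
  have hz0 : 0 < z := lt_of_le_of_ne hz (by rintro rfl; norm_num at hLz; linarith)
  have hx : 0 ≤ x := nonneg_of_mul_nonneg_left hxz hz0
  have hLy : L12 * x ≤ y := le_of_mul_le_mul_right (by linarith) hz0
  have hyU : y ≤ U12 * x := le_of_mul_le_mul_right (by linarith) hz0
  have hy : 0 ≤ y := (mul_nonneg hL12 hx).trans hLy
  have hU12 : 0 < U12 := hL12.trans_lt h12
  have hU11 : 0 ≤ U11 := hL11.trans h11
  have hU22 : 0 < U22 := hL22.trans_le h22
  have hfL : f L12 = L12 / (√(1 + L12 ^ 2) + 1) := by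
    rcases hL12.eq_or_lt with h | h
    · simp [← h, hf0]
    · rw [hf _ h, sqrt_one_add_sq_sub_one_div h]
  have hfU : f U12 = U12 / (√(1 + U12 ^ 2) + 1) := by
    rw [hf _ hU12, sqrt_one_add_sq_sub_one_div hU12]
  have hp := half_slope_mul_le hL12 hx hLy
  have hq := le_half_slope_mul hU12.le hy hyU
  rw [← hfL] at hp
  rw [← hfU] at hq
  have hp0 : 0 ≤ f L12 := by rw [hfL]; positivity
  have hq0 : 0 ≤ f U12 := by rw [hfU]; positivity
  generalize f L12 = p at *
  generalize f U12 = q at *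
  have hr : √(x ^ 2 + y ^ 2) ^ 2 = x ^ 2 + y ^ 2 := Real.sq_sqrt (by positivity)
  have har := Real.sqrt_le_sqrt hLr
  have hrA := Real.sqrt_le_sqrt hrU
  have hbz := Real.sqrt_le_sqrt hLz
  have hzB := Real.sqrt_le_sqrt hzU
  rw [Real.sqrt_sq hz] at hbz hzB
  have hchord : (1 + p * q) * √(x ^ 2 + y ^ 2) ≤ (1 - p * q) * x + (p + q) * y := by
    rcases hx.eq_or_lt with rfl | hx
    · have hy0 : y = 0 := by linarith
      simp [hy0]
    · exact norm_le_of_half_slope (by positivity) hr hp hq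
  have hpq : 0 < 1 + p * q := by positivity
  have hcoef : √(x ^ 2 + y ^ 2) * z ≤ (1 - p * q) / (1 + p * q) * (x * z) +
      (p + q) / (1 + p * q) * (y * z) := by
    have h := mul_le_mul_of_nonneg_right ((le_div_iff₀' hpq).2 hchord) hz
    calc
      _ ≤ _ := h
      _ = _ := by ring
  have hscaled := mul_le_mul_of_nonneg_left hcoef
    (by positivity : 0 ≤ (√L11 + √U11) * (√L22 + √U22))
  have hquad := rectangle_quadratic_nonneg (Real.sqrt_nonneg L11) (Real.sqrt_nonneg L22)
    har hrA hbz hzB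
  have hA := Real.sq_sqrt hU11
  have hB := Real.sq_sqrt hU22.le
  rw [hπ₀, hπ₁, hπ₂, hπ₃, hπ₄, Real.sqrt_mul (by positivity), Real.sqrt_mul (by positivity),
    Real.sqrt_mul hL11, Real.sqrt_mul hL22.le, Real.sqrt_mul hL11]
  linear_combination hquad + hscaled - (√L22 * √U22 + √U22 ^ 2) * hr -
    (z ^ 2 - √U22 ^ 2) * hA - (x ^ 2 + y ^ 2 - U11) * hB
end

section
/- For every x ∈ ℝ³ with L₁₁ ≤ x₁² + x₂² ≤ U₁₁, L₂₂ ≤ x₃² ≤ U₂₂, L₁₂·x₁x₃ ≤ x₂x₃ ≤ U₁₂·x₁x₃, x₁x₃ ≥ 0, and x₃ ≥ 0, one has π₀ + π₁·(x₁² + x₂²) + π₂·x₃² + π₃·x₁x₃ + π₄·x₂x₃ ≥ L₂₂·(x₁² + x₂²) + L₁₁·x₃² − L₁₁L₂₂. -/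
/-- The half-angle function `t ↦ (√(1 + t²) - 1) / t` takes values in `[0, 1)` and inverts
`a ↦ 2a / (1 - a²)`. -/
lemma half_angle_spec (f : ℝ → ℝ) (hf0 : f 0 = 0)
    (hf : ∀ t : ℝ, 0 < t → f t = (Real.sqrt (1 + t ^ 2) - 1) / t) {t : ℝ} (ht : 0 ≤ t) :
    0 ≤ f t ∧ f t < 1 ∧ t * (1 - f t ^ 2) = 2 * f t := by
  rcases ht.eq_or_lt with rfl | ht
  · simp [hf0]
  · have hw : Real.sqrt (1 + t ^ 2) ^ 2 = 1 + t ^ 2 := Real.sq_sqrt (by positivity)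
    have hw1 : 1 ≤ Real.sqrt (1 + t ^ 2) := Real.one_le_sqrt.mpr (by nlinarith)
    rw [hf t ht]
    refine ⟨div_nonneg (by linarith) ht.le, ?_, ?_⟩
    · rw [div_lt_one ht]
      nlinarith
    · field_simp
      linear_combination (-1 : ℝ) * hw

/-- Between the two rays whose half-angle tangents are `a` and `b`, the norm is bounded by its
linear interpolation. -/
lemma norm_le_sector_interpolation {a b x y r : ℝ} (ha : 0 ≤ a) (ha1 : a < 1)
    (hb : 0 ≤ b) (hb1 : b < 1) (hx : 0 ≤ x) (hy : 0 ≤ y) (hr : r ^ 2 = x ^ 2 + y ^ 2)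
    (h1 : 2 * a * x ≤ (1 - a ^ 2) * y) (h2 : (1 - b ^ 2) * y ≤ 2 * b * x) :
    r ≤ (1 - a * b) / (1 + a * b) * x + (a + b) / (1 + a * b) * y := by
  have hab : 0 ≤ a * b := mul_nonneg ha hb
  have hab1 : a * b ≤ 1 := mul_le_one₀ ha1.le hb hb1.le
  have hpos : 0 < 1 + a * b := by linarith
  have key : r * (1 + a * b) ≤ (1 - a * b) * x + (a + b) * y := by
    refine abs_le_of_sq_le_sq' ?_ ?_ |>.2
    · have := mul_nonneg (sub_nonneg.mpr h1) (sub_nonneg.mpr h2)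
      rw [mul_pow, hr]
      linarith
    · have := mul_nonneg (sub_nonneg.mpr hab1) hx
      positivity
  have heq : (1 - a * b) / (1 + a * b) * x + (a + b) / (1 + a * b) * y =
      ((1 - a * b) * x + (a + b) * y) / (1 + a * b) := by ring
  rwa [heq, le_div_iff₀ hpos]

/-- The cut in the variables `r`, `s` on the box `[l₁, u₁] × [l₂, u₂]`. -/
lemma box_cut {l₁ u₁ l₂ u₂ r s : ℝ} (hl₁ : 0 ≤ l₁) (hl₂ : 0 ≤ l₂)
    (hr : l₁ ≤ r) (hr' : r ≤ u₁) (hs : l₂ ≤ s) (hs' : s ≤ u₂) :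
    l₂ ^ 2 * r ^ 2 + l₁ ^ 2 * s ^ 2 - l₁ ^ 2 * l₂ ^ 2 ≤
      -(l₁ * l₂ * u₁ * u₂) - l₂ * u₂ * r ^ 2 - l₁ * u₁ * s ^ 2 +
        (l₁ + u₁) * (l₂ + u₂) * (r * s) := by
  have hu₁ : 0 ≤ l₁ + u₁ := by linarith
  have hu₂ : 0 ≤ l₂ + u₂ := by linarith
  have e₁ := mul_nonneg (mul_nonneg hl₂ hu₂)
    (mul_nonneg (sub_nonneg.mpr hr) (sub_nonneg.mpr hr'))
  have e₂ := mul_nonneg (mul_nonneg hl₁ hu₁)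
    (mul_nonneg (sub_nonneg.mpr hs) (sub_nonneg.mpr hs'))
  have e₃ := mul_nonneg (mul_nonneg hu₁ hu₂)
    (mul_nonneg (sub_nonneg.mpr hr) (sub_nonneg.mpr hs))
  linarith


theorem stmt_15 (L11 L22 L12 U11 U22 U12 : ℝ)
    (hL11 : 0 ≤ L11) (h11 : L11 ≤ U11)
    (hL22 : 0 < L22) (h22 : L22 ≤ U22)
    (hL12 : 0 ≤ L12) (h12 : L12 < U12)
    (f : ℝ → ℝ) (hf0 : f 0 = 0)
    (hf : ∀ t : ℝ, 0 < t → f t = (Real.sqrt (1 + t ^ 2) - 1) / t)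
    (π₀ π₁ π₂ π₃ π₄ : ℝ)
    (hπ₀ : π₀ = -Real.sqrt (L11 * L22 * U11 * U22))
    (hπ₁ : π₁ = -Real.sqrt (L22 * U22))
    (hπ₂ : π₂ = -Real.sqrt (L11 * U11))
    (hπ₃ : π₃ = (Real.sqrt L11 + Real.sqrt U11) * (Real.sqrt L22 + Real.sqrt U22) *
      ((1 - f L12 * f U12) / (1 + f L12 * f U12)))
    (hπ₄ : π₄ = (Real.sqrt L11 + Real.sqrt U11) * (Real.sqrt L22 + Real.sqrt U22) *
      ((f L12 + f U12) / (1 + f L12 * f U12))) :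
    ∀ x1 x2 x3 : ℝ,
      L11 ≤ x1 ^ 2 + x2 ^ 2 → x1 ^ 2 + x2 ^ 2 ≤ U11 →
      L22 ≤ x3 ^ 2 → x3 ^ 2 ≤ U22 →
      L12 * (x1 * x3) ≤ x2 * x3 → x2 * x3 ≤ U12 * (x1 * x3) →
      0 ≤ x1 * x3 → 0 ≤ x3 →
      π₀ + π₁ * (x1 ^ 2 + x2 ^ 2) + π₂ * x3 ^ 2 + π₃ * (x1 * x3) + π₄ * (x2 * x3) ≥
        L22 * (x1 ^ 2 + x2 ^ 2) + L11 * x3 ^ 2 - L11 * L22 := by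
  intro x1 x2 x3 hr hr' hs hs' h1 h2 h13 h3
  have hx3 : 0 < x3 := h3.lt_of_ne (by rintro rfl; linarith)
  have hx1 : 0 ≤ x1 := nonneg_of_mul_nonneg_left h13 hx3
  have hl : L12 * x1 ≤ x2 := le_of_mul_le_mul_right (by linarith) hx3
  have hu : x2 ≤ U12 * x1 := le_of_mul_le_mul_right (by linarith) hx3
  have hx2 : 0 ≤ x2 := (mul_nonneg hL12 hx1).trans hl
  obtain ⟨ha, ha1, hta⟩ := half_angle_spec f hf0 hf hL12
  obtain ⟨hb, hb1, htb⟩ := half_angle_spec f hf0 hf (hL12.trans h12.le)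
  have hq : 0 ≤ x1 ^ 2 + x2 ^ 2 := by positivity
  have hsector := norm_le_sector_interpolation ha ha1 hb hb1 hx1 hx2 (Real.sq_sqrt hq)
    (by
      have : 0 ≤ 1 - f L12 ^ 2 := by nlinarith
      have := mul_le_mul_of_nonneg_left hl this
      rw [← hta]
      linarith)
    (by
      have : 0 ≤ 1 - f U12 ^ 2 := by nlinarith
      have := mul_le_mul_of_nonneg_left hu this
      rw [← htb]
      linarith)
  have hbox := box_cut (Real.sqrt_nonneg L11) (Real.sqrt_nonneg L22) (Real.sqrt_le_sqrt hr)
    (Real.sqrt_le_sqrt hr') (Real.sqrt_le_iff.mpr ⟨h3, hs⟩) (Real.le_sqrt_of_sq_le hs')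
  have hU11 : 0 ≤ U11 := hL11.trans h11
  rw [Real.sq_sqrt hL11, Real.sq_sqrt hL22.le, Real.sq_sqrt hq] at hbox
  rw [Real.sqrt_mul (by positivity), Real.sqrt_mul (by positivity), Real.sqrt_mul hL11] at hπ₀
  rw [Real.sqrt_mul hL22.le] at hπ₁
  rw [Real.sqrt_mul hL11] at hπ₂
  have hK : 0 ≤ (Real.sqrt L11 + Real.sqrt U11) * (Real.sqrt L22 + Real.sqrt U22) * x3 := by
    positivity
  have hscaled := mul_le_mul_of_nonneg_left hsector hK
  rw [hπ₀, hπ₁, hπ₂, hπ₃, hπ₄]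
  linarith
end

section
/- Let F := {x ∈ ℝⁿ : x ≥ 0 componentwise, ‖x‖ ≤ 1} and let G be the closure of the convex hull of {(x, x xᵀ) : x ∈ F} in ℝⁿ × (n×n real matrices). Then for every s ∈ ℝⁿ with s ≥ 0 and ‖s‖ = 1, and every (x, X) ∈ G: tr(X) ≤ 1 + sᵀ(Xe − x) and tr(X) ≤ eᵀx − sᵀ(Xe − x), where e ∈ ℝⁿ is the all-ones vector. -/
open Matrix

/-- The Euclidean norm of a nonnegative vector is at most the sum of its coordinates. -/
lemma EuclideanSpace.norm_le_sum_of_nonneg {ι : Type*} [Fintype ι] (x : EuclideanSpace ℝ ι)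
    (hx : ∀ i, 0 ≤ x i) : ‖x‖ ≤ ∑ i, x i := by
  refine (pow_le_pow_iff_left₀ (norm_nonneg x) (Finset.sum_nonneg fun i _ => hx i) two_ne_zero).1 ?_
  rw [EuclideanSpace.real_norm_sq_eq]
  exact Finset.sum_sq_le_sq_sum_of_nonneg fun i _ => hx i

/-- The linear functional `(x, X) ↦ sᵀ(Xe - x)`. -/
lemma isLinearMap_dotProduct_mulVec_one_sub {ι : Type*} [Fintype ι] (s : ι → ℝ) :
    IsLinearMap ℝ fun p : EuclideanSpace ℝ ι × Matrix ι ι ℝ =>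
      s ⬝ᵥ (p.2.mulVec (fun _ => 1) - p.1.ofLp) where
  map_add p q := by
    simp only [Prod.snd_add, Prod.fst_add, WithLp.ofLp_add, add_mulVec, dotProduct_sub,
      dotProduct_add]
    ring
  map_smul c p := by
    simp only [Prod.smul_snd, Prod.smul_fst, WithLp.ofLp_smul, smul_mulVec, dotProduct_sub,
      dotProduct_smul, smul_sub]

lemma continuous_dotProduct_mulVec_one_sub {ι : Type*} [Fintype ι] (s : ι → ℝ) :
    Continuous fun p : EuclideanSpace ℝ ι × Matrix ι ι ℝ =>
      s ⬝ᵥ (p.2.mulVec (fun _ => 1) - p.1.ofLp) := by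
  refine continuous_const.dotProduct ?_
  exact (continuous_snd.matrix_mulVec continuous_const).sub
    ((PiLp.continuous_ofLp 2 _).comp continuous_fst)

theorem stmt_16 (n : ℕ)
    (F : Set (EuclideanSpace ℝ (Fin n)))
    (hF : F = {x | (∀ i, 0 ≤ x i) ∧ ‖x‖ ≤ 1})
    (G : Set (EuclideanSpace ℝ (Fin n) × Matrix (Fin n) (Fin n) ℝ))
    (hG : G = closure (convexHull ℝ {p | ∃ x ∈ F, p = (x, Matrix.vecMulVec x x)})) :
    ∀ s : EuclideanSpace ℝ (Fin n), (∀ i, 0 ≤ s i) → ‖s‖ = 1 →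
      ∀ p ∈ G,
        p.2.trace ≤ 1 + s ⬝ᵥ (p.2.mulVec (fun _ => 1) - (show Fin n → ℝ from p.1)) ∧
        p.2.trace ≤ (∑ i, p.1 i) -
          s ⬝ᵥ (p.2.mulVec (fun _ => 1) - (show Fin n → ℝ from p.1)) := by
  intro s hs hs1
  have hL := isLinearMap_dotProduct_mulVec_one_sub s.ofLp
  have hLc := continuous_dotProduct_mulVec_one_sub s.ofLp
  set L : EuclideanSpace ℝ (Fin n) × Matrix (Fin n) (Fin n) ℝ → ℝ :=
    fun p => s.ofLp ⬝ᵥ (p.2.mulVec (fun _ => 1) - p.1.ofLp) with hLdef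
  let S : Set (EuclideanSpace ℝ (Fin n) × Matrix (Fin n) (Fin n) ℝ) :=
    {p | p.2.trace - L p ≤ 1} ∩ {p | p.2.trace - (∑ i, p.1 i) + L p ≤ 0}
  have hconv : Convex ℝ S := by
    refine (convex_halfSpace_le ⟨fun p q => ?_, fun c p => ?_⟩ 1).inter
      (convex_halfSpace_le ⟨fun p q => ?_, fun c p => ?_⟩ 0)
    · rw [hL.map_add, Prod.snd_add, trace_add]; ring
    · rw [hL.map_smul, Prod.smul_snd, trace_smul, smul_sub]
    · simp only [hL.map_add, Prod.snd_add, Prod.fst_add, trace_add, PiLp.add_apply,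
        Finset.sum_add_distrib]
      ring
    · simp only [hL.map_smul, Prod.smul_snd, Prod.smul_fst, trace_smul, PiLp.smul_apply,
        ← Finset.smul_sum, smul_sub, smul_add]
  have htr : Continuous fun p : EuclideanSpace ℝ (Fin n) × Matrix (Fin n) (Fin n) ℝ =>
      p.2.trace := continuous_snd.matrix_trace
  have hclosed : IsClosed S :=
    (isClosed_le (htr.sub hLc) continuous_const).inter
      (isClosed_le ((htr.sub (by fun_prop)).add hLc) continuous_const)
  have hsub : {p | ∃ x ∈ F, p = (x, Matrix.vecMulVec x x)} ⊆ S := by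
    rintro _ ⟨x, hx, rfl⟩
    rw [hF] at hx
    obtain ⟨hx0, hx1⟩ := hx
    have htrace : (vecMulVec x.ofLp x.ofLp).trace = ‖x‖ ^ 2 := by
      rw [EuclideanSpace.real_norm_sq_eq, trace_vecMulVec]
      simp [dotProduct, sq]
    have hLx : L (x, vecMulVec x.ofLp x.ofLp) =
        (s.ofLp ⬝ᵥ x.ofLp) * ((∑ i, x i) - 1) := by
      have h : vecMulVec x.ofLp x.ofLp *ᵥ (fun _ => 1) = (∑ i, x i) • x.ofLp := by
        ext i
        simp [mulVec, dotProduct, vecMulVec_apply, ← Finset.mul_sum, mul_comm]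
      simp only [hLdef, h, dotProduct_sub, dotProduct_smul, smul_eq_mul]
      ring
    have ht0 : 0 ≤ s.ofLp ⬝ᵥ x.ofLp :=
      Finset.sum_nonneg fun i _ => mul_nonneg (hs i) (hx0 i)
    have ht1 : s.ofLp ⬝ᵥ x.ofLp ≤ 1 := by
      have h := real_inner_le_norm x s
      rw [EuclideanSpace.inner_eq_star_dotProduct, hs1, mul_one] at h
      exact h.trans hx1
    have hr := EuclideanSpace.norm_le_sum_of_nonneg x hx0
    have hr0 := norm_nonneg x
    have hrr : ‖x‖ ^ 2 ≤ ‖x‖ := by nlinarith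
    constructor
    · simp only [Set.mem_ofPred_eq, hLx, htrace]
      nlinarith [mul_nonneg ht0 (sub_nonneg.2 hr),
        mul_nonneg (sub_nonneg.2 ht1) (sub_nonneg.2 hx1)]
    · simp only [Set.mem_ofPred_eq, hLx, htrace]
      nlinarith [mul_nonneg (sub_nonneg.2 ht1) (sub_nonneg.2 hr),
        mul_nonneg ht0 (sub_nonneg.2 hx1)]
  intro p hp
  rw [hG] at hp
  obtain ⟨h1, h2⟩ := closure_minimal (convexHull_min hsub hconv) hclosed hp
  simp only [Set.mem_ofPred_eq, hLdef] at h1 h2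
  constructor
  · change p.2.trace ≤ 1 + s.ofLp ⬝ᵥ (p.2.mulVec (fun _ => 1) - p.1.ofLp)
    linarith
  · change p.2.trace ≤ (∑ i, p.1 i) - s.ofLp ⬝ᵥ (p.2.mulVec (fun _ => 1) - p.1.ofLp)
    linarith
end

section
/- Let F := {x ∈ ℝⁿ : x ≥ 0 componentwise, ‖x‖ ≤ 1} and let G be the closure of the convex hull of {(x, x xᵀ) : x ∈ F} in ℝⁿ × (n×n real matrices). Let (I, J) be a partition of {1,…,n}. Then every (x, X) ∈ G satisfying [Xe − x]ᵢ ≥ 0 for all i ∈ I and [Xe − x]ⱼ ≤ 0 for all j ∈ J also satisfies the two second-order-cone inequalities tr(X) ≤ 1 − ‖[Xe − x]_J‖ and tr(X) ≤ eᵀx − ‖[Xe − x]_I‖, where [v]_K denotes the subvector of v indexed by K and ‖[v]_K‖ its Euclidean norm. -/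
open Matrix

/-- The scalar inequalities behind the cuts: `r` is the norm of a nonnegative vector,
`t` the sum of its entries and `a` its inner product with a nonnegative vector of norm at most 1. -/
theorem sq_le_of_sum_of_inner {r t a : ℝ} (hr0 : 0 ≤ r) (hr1 : r ≤ 1) (hrt : r ≤ t)
    (ha0 : 0 ≤ a) (har : a ≤ r) :
    r ^ 2 ≤ 1 + (t - 1) * a ∧ r ^ 2 ≤ t - (t - 1) * a := by
  rcases le_total t 1 with ht | ht
  · constructor <;> nlinarith [mul_nonneg (sub_nonneg.2 ht) (sub_nonneg.2 har),
      mul_nonneg (sub_nonneg.2 ht) ha0, mul_nonneg hr0 (sub_nonneg.2 hrt),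
      mul_nonneg hr0 (sub_nonneg.2 hr1)]
  · constructor <;> nlinarith [mul_nonneg (sub_nonneg.2 ht) (sub_nonneg.2 har),
      mul_nonneg (sub_nonneg.2 ht) ha0, mul_nonneg (sub_nonneg.2 hr1) (sub_nonneg.2 ht),
      mul_nonneg hr0 (sub_nonneg.2 hr1)]

/-- The linear cuts at a rank-one point. -/
theorem linear_cuts_vecMulVec {n : ℕ} (s : Fin n → ℝ) (hs : ∀ i, 0 ≤ s i)
    (hs1 : ∑ i, s i ^ 2 ≤ 1) (x : EuclideanSpace ℝ (Fin n)) (hx : ∀ i, 0 ≤ x i)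
    (hx1 : ‖x‖ ≤ 1) :
    (vecMulVec x x).trace ≤ 1 + ∑ i, s i * ((∑ j, vecMulVec x x i j) - x i) ∧
    (vecMulVec x x).trace ≤ (∑ i, x i) - ∑ i, s i * ((∑ j, vecMulVec x x i j) - x i) := by
  have hsq : ‖x‖ ^ 2 = ∑ i, x i ^ 2 := EuclideanSpace.real_norm_sq_eq x
  have htr : (vecMulVec x x).trace = ‖x‖ ^ 2 := by
    rw [hsq]
    simp [Matrix.trace, vecMulVec_apply, sq]
  have hcut : ∑ i, s i * ((∑ j, vecMulVec x x i j) - x i)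
      = ((∑ i, x i) - 1) * ∑ i, s i * x i := by
    rw [Finset.mul_sum]
    refine Finset.sum_congr rfl fun i _ => ?_
    simp only [vecMulVec_apply, ← Finset.mul_sum]
    ring
  have hsum : ‖x‖ ≤ ∑ i, x i := by
    refine le_of_sq_le_sq ?_ (Finset.sum_nonneg fun i _ => hx i)
    rw [hsq]
    exact Finset.sum_sq_le_sq_sum_of_nonneg fun i _ => hx i
  have hinner : ∑ i, s i * x i ≤ ‖x‖ := by
    refine le_of_sq_le_sq ?_ (norm_nonneg x)
    calc (∑ i, s i * x i) ^ 2 ≤ (∑ i, s i ^ 2) * ∑ i, x i ^ 2 :=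
          Finset.sum_mul_sq_le_sq_mul_sq _ _ _
      _ ≤ 1 * ∑ i, x i ^ 2 := by gcongr
      _ = ‖x‖ ^ 2 := by rw [one_mul, hsq]
  rw [htr, hcut]
  exact sq_le_of_sum_of_inner (norm_nonneg x) hx1 hsum
    (Finset.sum_nonneg fun i _ => mul_nonneg (hs i) (hx i)) hinner

/-- The linear cuts hold on the closed convex hull of the rank-one points. -/
theorem linear_cuts {n : ℕ} (s : Fin n → ℝ) (hs : ∀ i, 0 ≤ s i) (hs1 : ∑ i, s i ^ 2 ≤ 1)
    (p : EuclideanSpace ℝ (Fin n) × Matrix (Fin n) (Fin n) ℝ)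
    (hp : p ∈ closure (convexHull ℝ {p : EuclideanSpace ℝ (Fin n) × Matrix (Fin n) (Fin n) ℝ |
      ∃ x ∈ {x : EuclideanSpace ℝ (Fin n) | (∀ i, 0 ≤ x i) ∧ ‖x‖ ≤ 1},
        p = (x, vecMulVec x x)})) :
    p.2.trace ≤ 1 + ∑ i, s i * ((∑ j, p.2 i j) - p.1 i) ∧
    p.2.trace ≤ (∑ i, p.1 i) - ∑ i, s i * ((∑ j, p.2 i j) - p.1 i) := by
  let C : Set (EuclideanSpace ℝ (Fin n) × Matrix (Fin n) (Fin n) ℝ) :=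
    {p | p.2.trace ≤ 1 + ∑ i, s i * ((∑ j, p.2 i j) - p.1 i) ∧
      p.2.trace ≤ (∑ i, p.1 i) - ∑ i, s i * ((∑ j, p.2 i j) - p.1 i)}
  have hclosed : IsClosed C := by
    have htr : Continuous fun p : EuclideanSpace ℝ (Fin n) × Matrix (Fin n) (Fin n) ℝ =>
        p.2.trace := continuous_snd.matrix_trace
    have hent (i j : Fin n) : Continuous
        fun p : EuclideanSpace ℝ (Fin n) × Matrix (Fin n) (Fin n) ℝ => p.2 i j :=
      continuous_snd.matrix_elem i j
    exact (isClosed_le htr (by fun_prop)).inter (isClosed_le htr (by fun_prop))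
  have hconvex : Convex ℝ C := by
    rintro p ⟨hp1, hp2⟩ q ⟨hq1, hq2⟩ a b ha hb hab
    have hlin : ∑ i, s i * ((∑ j, (a • p + b • q).2 i j) - (a • p + b • q).1 i)
        = a * ∑ i, s i * ((∑ j, p.2 i j) - p.1 i)
          + b * ∑ i, s i * ((∑ j, q.2 i j) - q.1 i) := by
      simp only [Finset.mul_sum, ← Finset.sum_add_distrib]
      refine Finset.sum_congr rfl fun i _ => ?_
      simp [Finset.sum_add_distrib, ← Finset.mul_sum]
      ring
    have hsum : ∑ i, (a • p + b • q).1 i = a * ∑ i, p.1 i + b * ∑ i, q.1 i := by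
      simp [Finset.sum_add_distrib, ← Finset.mul_sum]
    have htr : (a • p + b • q).2.trace = a * p.2.trace + b * q.2.trace := by
      simp [Matrix.trace_add, Matrix.trace_smul]
    constructor
    · rw [hlin, htr]
      nlinarith [mul_le_mul_of_nonneg_left hp1 ha, mul_le_mul_of_nonneg_left hq1 hb]
    · rw [hlin, htr, hsum]
      nlinarith [mul_le_mul_of_nonneg_left hp2 ha, mul_le_mul_of_nonneg_left hq2 hb]
  refine closure_minimal (convexHull_min ?_ hconvex) hclosed hp
  rintro _ ⟨x, ⟨hx, hx1⟩, rfl⟩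
  exact linear_cuts_vecMulVec s hs hs1 x hx hx1

/-- The Euclidean norm of a nonnegative subvector is attained by pairing with a nonnegative
vector of norm at most 1. -/
theorem exists_nonneg_sum_mul_eq_sqrt {ι : Type*} [Fintype ι] [DecidableEq ι] (K : Finset ι)
    (w : ι → ℝ) (hw : ∀ i ∈ K, 0 ≤ w i) :
    ∃ s : ι → ℝ, (∀ i, 0 ≤ s i) ∧ ∑ i, s i ^ 2 ≤ 1 ∧
      ∑ i, s i * w i = √(∑ i ∈ K, w i ^ 2) := by
  have h0 : 0 ≤ ∑ i ∈ K, w i ^ 2 := Finset.sum_nonneg fun i _ => sq_nonneg _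
  refine ⟨fun i => if i ∈ K then w i / √(∑ i ∈ K, w i ^ 2) else 0, fun i => ?_, ?_, ?_⟩
  · dsimp only
    split_ifs with h
    · exact div_nonneg (hw i h) (Real.sqrt_nonneg _)
    · exact le_rfl
  · simp only [ite_pow, ne_eq, OfNat.ofNat_ne_zero, not_false_eq_true, zero_pow,
      Finset.sum_ite_mem, Finset.univ_inter, div_pow, Real.sq_sqrt h0, ← Finset.sum_div]
    exact div_self_le_one _
  · simp only [ite_mul, zero_mul, Finset.sum_ite_mem, Finset.univ_inter, div_mul_eq_mul_div,
      ← sq, ← Finset.sum_div]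
    exact Real.div_sqrt

theorem stmt_17 (n : ℕ)
    (F : Set (EuclideanSpace ℝ (Fin n)))
    (hF : F = {x | (∀ i, 0 ≤ x i) ∧ ‖x‖ ≤ 1})
    (G : Set (EuclideanSpace ℝ (Fin n) × Matrix (Fin n) (Fin n) ℝ))
    (hG : G = closure (convexHull ℝ {p | ∃ x ∈ F, p = (x, Matrix.vecMulVec x x)}))
    (I J : Finset (Fin n)) (hIJ : I ∪ J = Finset.univ) (hdisj : Disjoint I J) :
    ∀ p ∈ G,
      (∀ i ∈ I, 0 ≤ (p.2.mulVec (fun _ => 1) - (show Fin n → ℝ from p.1)) i) →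
      (∀ j ∈ J, (p.2.mulVec (fun _ => 1) - (show Fin n → ℝ from p.1)) j ≤ 0) →
      p.2.trace ≤ 1 -
          Real.sqrt (∑ j ∈ J, ((p.2.mulVec (fun _ => 1) - (show Fin n → ℝ from p.1)) j) ^ 2) ∧
      p.2.trace ≤ (∑ i, p.1 i) -
          Real.sqrt (∑ i ∈ I, ((p.2.mulVec (fun _ => 1) - (show Fin n → ℝ from p.1)) i) ^ 2) := by
  subst hF hG
  intro p hp hI hJ
  have hv (i : Fin n) : (p.2.mulVec (fun _ => 1) - (show Fin n → ℝ from p.1)) i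
      = (∑ j, p.2 i j) - p.1 i := by
    simp [Matrix.mulVec, dotProduct]
  simp only [hv] at hI hJ ⊢
  constructor
  · obtain ⟨s, hs, hs1, hsv⟩ := exists_nonneg_sum_mul_eq_sqrt J
      (fun i => -((∑ j, p.2 i j) - p.1 i)) fun i hi => neg_nonneg.2 (hJ i hi)
    simp only [neg_sq, mul_neg, Finset.sum_neg_distrib] at hsv
    linarith [(linear_cuts s hs hs1 p hp).1]
  · obtain ⟨s, hs, hs1, hsv⟩ := exists_nonneg_sum_mul_eq_sqrt I
      (fun i => (∑ j, p.2 i j) - p.1 i) hI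
    linarith [(linear_cuts s hs hs1 p hp).2]
end
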